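/- Let n be even with n ≥ 8 and let L = F2(β_4,…,β_n,γ) be an n-dimensional complex non-strongly nilpotent filiform Leibniz algebra of the second family. Then L is isomorphic, as a Leibniz algebra, to an algebra F2(β'_4,…,β'_n,γ') where either: (a) for some s with 2 ≤ s ≤ (n−2)/2, β'_{2s} = 1 and β'_j = 0 for all 4 ≤ j ≤ n−2 with j ≠ 2s (with β'_{n−1}, β'_n, γ' arbitrary); or (b) β'_{2i} = 0 for all 2 ≤ i ≤ (n−2)/2, i.e. β'_4 = β'_6 = … = β'_{n−2} = 0 (with β'_5, β'_7, …, β'_{n−1}, β'_n, γ' arbitrary). -/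

import Mathlib

open Finset

/-- The basis vector `e_i` (1-indexed) of `ℂ^n`; zero if `i` is out of range. -/
noncomputable def E (n : ℕ) (i : ℕ) : Fin n → ℂ :=
  if h : 1 ≤ i ∧ i ≤ n then Pi.single (⟨i - 1, by omega⟩ : Fin n) 1 else 0

/-- The bilinear bracket on `ℂ^n` determined by the products `m i j` of the
(1-indexed) basis vectors `e_i`, `e_j`. -/
noncomputable def bracketOf (n : ℕ) (m : ℕ → ℕ → Fin n → ℂ)
    (x y : Fin n → ℂ) : Fin n → ℂ :=
  ∑ i : Fin n, ∑ j : Fin n, (x i * y j) • m (i.1 + 1) (j.1 + 1)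

/-- `P` is a pre-derivation of the algebra with bracket `br`. -/
def IsPreDeriv (n : ℕ) (br : (Fin n → ℂ) → (Fin n → ℂ) → Fin n → ℂ)
    (P : Module.End ℂ (Fin n → ℂ)) : Prop :=
  ∀ x y z, P (br (br x y) z) =
    br (br (P x) y) z + br (br x (P y)) z + br (br x y) (P z)

/-- Multiplication table of the second family `F2(β₄,…,βₙ,γ)` of filiform Leibniz
algebras: `[e₁,e₁]=e₃`; `[eᵢ,e₁]=e_{i+1}` for `3 ≤ i ≤ n-1`;
`[e₁,e₂]=∑_{t=4}^{n} β_t e_t`; `[e₂,e₂]=γ eₙ`;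
`[eⱼ,e₂]=∑_{t=j+2}^{n} β_{t-j+2} e_t` for `3 ≤ j ≤ n-2`; all other products zero. -/
noncomputable def F2mul (n : ℕ) (β : ℕ → ℂ) (γ : ℂ) (i j : ℕ) : Fin n → ℂ :=
  if i = 1 ∧ j = 1 then E n 3
  else if 3 ≤ i ∧ i ≤ n - 1 ∧ j = 1 then E n (i + 1)
  else if i = 1 ∧ j = 2 then ∑ t ∈ Icc 4 n, β t • E n t
  else if i = 2 ∧ j = 2 then γ • E n n
  else if 3 ≤ i ∧ i ≤ n - 2 ∧ j = 2 then ∑ t ∈ Icc (i + 2) n, β (t - i + 2) • E n t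
  else 0

open PowerSeries in
lemma PowerSeries.exists_eq_add_X_sq_mul (f : ℂ⟦X⟧) :
    ∃ g : ℂ⟦X⟧, (∀ k, coeff k g = coeff (k + 2) f) ∧
      f = coeff 0 f • 1 + coeff 1 f • X + X ^ 2 * g := by
  refine ⟨PowerSeries.mk fun k => coeff (k + 2) f, by simp, ?_⟩
  ext k
  rcases k with _ | _ | k
  · simp
  · simp [coeff_one, coeff_X_pow_mul']
  · rw [map_add, map_add, show k + 1 + 1 = k + 2 from rfl, coeff_X_pow_mul]
    simp [coeff_one, coeff_X]

section SquareLinear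

open PowerSeries

variable {N : ℕ} {R : ℂ⟦X⟧ →ₗ[ℂ] ℂ⟦X⟧}

/-- A map commuting with multiplication by `X ^ 2` and killing `1` and `X` vanishes. -/
lemma squareLinear_eq_zero (h0 : X ^ N ∣ R 1) (h1 : X ^ N ∣ R X)
    (h2 : ∀ f, X ^ N ∣ R (X ^ 2 * f) - X ^ 2 * R f) (f : ℂ⟦X⟧) : X ^ N ∣ R f := by
  suffices H : ∀ j ≤ N, ∀ f, X ^ j ∣ R f from H N le_rfl f
  intro j
  induction j with
  | zero => simp
  | succ j ih =>
    intro hj f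
    obtain ⟨g, -, hg⟩ := f.exists_eq_add_X_sq_mul
    obtain ⟨a, ha⟩ := (pow_dvd_pow X hj).trans h0
    obtain ⟨b, hb⟩ := (pow_dvd_pow X hj).trans h1
    obtain ⟨c, hc⟩ := (pow_dvd_pow X hj).trans (h2 g)
    obtain ⟨d, hd⟩ := ih (by omega) g
    rw [hg, map_add, map_add, map_smul, map_smul]
    refine ⟨coeff 0 f • a + coeff 1 f • b + c + X * d, ?_⟩
    simp only [smul_eq_C_mul]
    linear_combination C (coeff 0 f) * ha + C (coeff 1 f) * hb + hc + X ^ 2 * hd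

lemma squareLinear_even_eq_zero (h0 : X ^ N ∣ R 1)
    (h2 : ∀ f, X ^ N ∣ R (X ^ 2 * f) - X ^ 2 * R f) (f : ℂ⟦X⟧)
    (hf : ∀ k, Odd k → coeff k f = 0) : X ^ N ∣ R f := by
  suffices H : ∀ j ≤ N, ∀ f : ℂ⟦X⟧, (∀ k, Odd k → coeff k f = 0) → X ^ j ∣ R f from
    H N le_rfl f hf
  intro j
  induction j with
  | zero => simp
  | succ j ih =>
    intro hj f hf
    obtain ⟨g, hg2, hg⟩ := f.exists_eq_add_X_sq_mul
    obtain ⟨a, ha⟩ := (pow_dvd_pow X hj).trans h0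
    obtain ⟨c, hc⟩ := (pow_dvd_pow X hj).trans (h2 g)
    obtain ⟨d, hd⟩ := ih (by omega) g fun k hk => by
      rw [hg2]; exact hf _ (hk.add_even even_two)
    rw [hf 1 odd_one, zero_smul] at hg
    rw [hg, map_add, map_add, map_smul, map_zero]
    refine ⟨coeff 0 f • a + c + X * d, ?_⟩
    simp only [smul_eq_C_mul]
    linear_combination C (coeff 0 f) * ha + hc + X ^ 2 * hd

lemma squareLinear_X_mul (h0 : X ^ N ∣ R 1)
    (h2 : ∀ f, X ^ N ∣ R (X ^ 2 * f) - X ^ 2 * R f) (f : ℂ⟦X⟧) :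
    X ^ N ∣ R (X * f) + X * R f - f * R X := by
  let S : ℂ⟦X⟧ →ₗ[ℂ] ℂ⟦X⟧ :=
    R ∘ₗ LinearMap.mulLeft ℂ X + LinearMap.mulLeft ℂ X ∘ₗ R - LinearMap.mulRight ℂ (R X)
  have hS : ∀ f, S f = R (X * f) + X * R f - f * R X := fun f => rfl
  rw [← hS]
  apply squareLinear_eq_zero
  · obtain ⟨a, ha⟩ := h0
    refine ⟨X * a, ?_⟩
    rw [hS, mul_one]
    linear_combination X * ha
  · obtain ⟨a, ha⟩ := h0
    obtain ⟨b, hb⟩ := h2 1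
    refine ⟨b + X ^ 2 * a, ?_⟩
    rw [hS]
    rw [mul_one, sq] at hb
    linear_combination hb + X ^ 2 * ha
  · intro f
    obtain ⟨a, ha⟩ := h2 f
    obtain ⟨b, hb⟩ := h2 (X * f)
    refine ⟨b + X * a, ?_⟩
    rw [hS, hS, show X * (X ^ 2 * f) = X ^ 2 * (X * f) by ring]
    linear_combination hb + X * ha

/-- If `R X` has order one, then the even part of any `b` with `R (X * b) = 0` vanishes. -/
lemma coeff_even_eq_zero_of_squareLinear {K : ℕ} (hK : K + 1 ≤ N) (h0 : X ^ N ∣ R 1)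
    (h2 : ∀ f, X ^ N ∣ R (X ^ 2 * f) - X ^ 2 * R f) {u b : ℂ⟦X⟧}
    (hu : R X = X * u) (hu0 : constantCoeff u ≠ 0) (hb : X ^ (K + 1) ∣ R (X * b))
    {k : ℕ} (hk : Even k) (hkK : k < K) : coeff k b = 0 := by
  let b₀ : ℂ⟦X⟧ := PowerSeries.mk fun k => if Even k then coeff k b else 0
  let b₁ : ℂ⟦X⟧ := PowerSeries.mk fun k => if Even k then 0 else coeff k b
  have hbb : X * b = X * b₀ + X * b₁ := by
    rw [← mul_add]
    congr 1
    ext k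
    by_cases h : Even k <;> simp [b₀, b₁, h]
  have e1 : X ^ N ∣ R (X * b₁) := by
    apply squareLinear_even_eq_zero h0 h2
    rintro (_ | k) hk
    · simp
    · rw [coeff_succ_X_mul]
      have : Even k := by grind
      simp [b₁, this]
  have e0 : X ^ N ∣ R b₀ := by
    apply squareLinear_even_eq_zero h0 h2
    intro k hk
    simp [b₀, Nat.not_even_iff_odd.2 hk]
  have hle : (X : ℂ⟦X⟧) ^ (K + 1) ∣ X ^ N := pow_dvd_pow X hK
  obtain ⟨c1, h1⟩ := hle.trans e1
  obtain ⟨c0, h0'⟩ := hle.trans e0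
  obtain ⟨c, hc⟩ := hle.trans (squareLinear_X_mul h0 h2 b₀)
  obtain ⟨d, hd⟩ := hb
  rw [hbb, map_add] at hd
  have key : X ^ K ∣ u * b₀ := by
    refine ⟨d - c1 + X * c0 - c, mul_left_cancel₀ X_ne_zero ?_⟩
    rw [hu] at hc
    linear_combination hd - h1 - hc + X * h0'
  have hunit : IsUnit u := isUnit_iff_constantCoeff.2 (isUnit_iff_ne_zero.2 hu0)
  have := X_pow_dvd_iff.1 (hunit.dvd_mul_left.1 key) k hkK
  simpa [b₀, hk] using this

lemma X_sq_dvd_squareLinear (hN : 2 ≤ N) (h0 : X ^ N ∣ R 1) (h1 : X ^ 2 ∣ R X)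
    (h2 : ∀ f, X ^ N ∣ R (X ^ 2 * f) - X ^ 2 * R f) (f : ℂ⟦X⟧) : X ^ 2 ∣ R f :=
  squareLinear_eq_zero ((pow_dvd_pow X hN).trans h0) h1
    (fun f => (pow_dvd_pow X hN).trans (h2 f)) f

lemma X_pow_succ_dvd_squareLinear (h0 : X ^ N ∣ R 1) (h1 : X ^ 2 ∣ R X)
    (h2 : ∀ f, X ^ N ∣ R (X ^ 2 * f) - X ^ 2 * R f) (k : ℕ) (hk : k + 1 ≤ N) (f : ℂ⟦X⟧)
    (hf : X ^ k ∣ f) : X ^ (k + 1) ∣ R f := by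
  induction k using Nat.strong_induction_on generalizing f with
  | _ k ih =>
    obtain rfl | rfl | ⟨k, rfl⟩ : k = 0 ∨ k = 1 ∨ ∃ j, k = j + 2 := by
      rcases k with _ | _ | k <;> simp
    · obtain ⟨g, -, hg⟩ := f.exists_eq_add_X_sq_mul
      obtain ⟨a, ha⟩ := (pow_dvd_pow X hk).trans h0
      obtain ⟨b, hb⟩ := (pow_dvd_pow X (show 0 + 1 ≤ 2 by omega)).trans h1
      obtain ⟨c, hc⟩ := (pow_dvd_pow X hk).trans (h2 g)
      rw [hg, map_add, map_add, map_smul, map_smul]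
      refine ⟨coeff 0 f • a + coeff 1 f • b + c + X * R g, ?_⟩
      simp only [smul_eq_C_mul]
      linear_combination C (coeff 0 f) * ha + C (coeff 1 f) * hb + hc
    · exact X_sq_dvd_squareLinear hk h0 h1 h2 f
    · obtain ⟨g, rfl⟩ := hf
      obtain ⟨a, ha⟩ := ih k (by omega) (by omega) (X ^ k * g) ⟨g, rfl⟩
      obtain ⟨c, hc⟩ := (pow_dvd_pow X hk).trans (h2 (X ^ k * g))
      rw [show X ^ (k + 2) * g = X ^ 2 * (X ^ k * g) by ring]
      exact ⟨c + a, by linear_combination hc + X ^ 2 * ha⟩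

end SquareLinear

section EulerField

open PowerSeries

lemma exists_eq_X_pow_mul_of_coeff {j : ℕ} {z : ℂ⟦X⟧} (hz : X ^ j ∣ z)
    (h : coeff j z = 0) : X ^ (j + 1) ∣ z := by
  rw [X_pow_dvd_iff] at hz ⊢
  intro m hm
  rcases Nat.lt_succ_iff_lt_or_eq.1 hm with h' | rfl
  · exact hz m h'
  · exact h

/-- The vector field `(aX + ⋯) d/dX` multiplies the coefficient of order `j` by `a j`. -/
lemma coeff_mul_derivative {a : ℂ} {q s z : ℂ⟦X⟧} {j : ℕ} (hq : q = X * (C a + X * s))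
    (hz : X ^ j ∣ z) : coeff j (q * derivative ℂ z) = a * j * coeff j z := by
  obtain ⟨w, rfl⟩ := hz
  have : q * derivative ℂ (X ^ j * w) =
      X ^ j * (C (a * j) * w + X * (s * C (j : ℂ) * w + (C a + X * s) * derivative ℂ w)) := by
    rw [hq, Derivation.leibniz, Derivation.leibniz_pow, derivative_X]
    rcases j with _ | j
    · simp [mul_assoc]
    · simp only [smul_eq_mul, nsmul_eq_mul, map_mul, map_natCast, Nat.add_sub_cancel]
      ring
  rw [this]
  have h0 := coeff_X_pow_mul
    (C (a * j) * w + X * (s * C (j : ℂ) * w + (C a + X * s) * derivative ℂ w)) j 0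
  have h1 := coeff_X_pow_mul w j 0
  rw [zero_add] at h0 h1
  rw [h0, h1]
  simp

lemma X_pow_dvd_of_eigenvector {a l : ℂ} {q s z : ℂ⟦X⟧} {m K : ℕ}
    (hq : q = X * (C a + X * s)) (hz : X ^ m ∣ z)
    (hl : ∀ j : ℕ, m ≤ j → a * j ≠ l) (h : X ^ K ∣ q * derivative ℂ z - C l * z) :
    X ^ K ∣ z := by
  by_cases hmK : K ≤ m
  · exact (pow_dvd_pow X hmK).trans hz
  have H : ∀ i, m + i ≤ K → X ^ (m + i) ∣ z := by
    intro i
    induction i with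
    | zero => exact fun _ => hz
    | succ i ih =>
      intro hi
      have hd := ih (by omega)
      refine exists_eq_X_pow_mul_of_coeff hd ?_
      have := X_pow_dvd_iff.1 h (m + i) (by omega)
      rw [map_sub, coeff_mul_derivative hq hd, coeff_C_mul, ← sub_mul] at this
      exact (mul_eq_zero.1 this).resolve_left (sub_ne_zero.2 (hl _ (by omega)))
  have := H (K - m) (by omega)
  rwa [Nat.add_sub_cancel' (by omega)] at this

/-- Removing the leading term of a series with a power of a uniformiser. -/
lemma X_pow_succ_dvd_sub {j : ℕ} {y v z : ℂ⟦X⟧} (hy : y = X * (1 + X * v))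
    (hz : X ^ j ∣ z) : X ^ (j + 1) ∣ z - C (coeff j z) * y ^ j := by
  have hyj : X ^ j ∣ y ^ j := by rw [hy, mul_pow]; exact dvd_mul_right _ _
  refine exists_eq_X_pow_mul_of_coeff (dvd_sub hz (dvd_mul_of_dvd_right hyj _)) ?_
  have h0 := coeff_X_pow_mul ((1 + X * v) ^ j) j 0
  rw [zero_add] at h0
  rw [map_sub, coeff_C_mul, hy, mul_pow, h0]
  simp

/-- A power series that is, to order `K`, an eigenvector of a vector field
`(a X + c b) d/dX` with `a ≠ 0` is a monomial in the coordinate linearising the field. -/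
lemma exists_eq_monomial_of_eigenvector {a c d : ℂ} {b : ℂ⟦X⟧} {K : ℕ} (ha : a ≠ 0)
    (hb2 : X ^ 2 ∣ b) (hbK : ¬ X ^ K ∣ b)
    (h : X ^ K ∣ (C a * X + C c * b) * derivative ℂ b - C d * b) :
    ∃ (e k : ℂ) (m : ℕ), k ≠ 0 ∧ 2 ≤ m ∧ m < K ∧
      X ^ K ∣ b - C k * (X + C e * b) ^ m := by
  have hb0 : b ≠ 0 := by rintro rfl; simp at hbK
  obtain ⟨s, hs⟩ := hb2
  set m := b.order.toNat with hm
  have hbm : X ^ m ∣ b := X_pow_order_dvd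
  have hbm0 : coeff m b ≠ 0 := coeff_order hb0
  have hmK : m < K := by
    by_contra! hle
    exact hbK ((pow_dvd_pow X hle).trans hbm)
  have hm2 : 2 ≤ m := by
    by_contra! hlt
    exact hbm0 (X_pow_dvd_iff.1 ⟨s, hs⟩ m hlt)
  have hq : C a * X + C c * b = X * (C a + X * (C c * s)) := by rw [hs]; ring
  have hd : d = a * m := by
    have := X_pow_dvd_iff.1 h m hmK
    rw [map_sub, coeff_mul_derivative hq hbm, coeff_C_mul, ← sub_mul] at this
    exact (sub_eq_zero.1 ((mul_eq_zero.1 this).resolve_right hbm0)).symm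
  have hm1 : (m : ℂ) - 1 ≠ 0 := by
    rw [sub_ne_zero]; exact_mod_cast (show m ≠ 1 by omega)
  obtain ⟨e, he⟩ : ∃ e : ℂ, c + e * d - a * e = 0 := by
    refine ⟨-c / (a * (m - 1)), ?_⟩
    rw [hd]; field_simp; ring
  refine ⟨e, coeff m b, m, hbm0, hm2, hmK, ?_⟩
  have hz := X_pow_succ_dvd_sub (y := X + C e * b) (v := C e * s) (by rw [hs]; ring) hbm
  refine X_pow_dvd_of_eigenvector hq hz (l := d) ?_ ?_
  · intro j hj hjd
    rw [hd] at hjd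
    have := mul_left_cancel₀ ha hjd
    norm_cast at this
    omega
  · obtain ⟨w, hw⟩ := h
    have he' : C c + C e * C d - C a * C e = (0 : ℂ⟦X⟧) := by
      rw [← map_mul, ← map_mul, ← map_add, ← map_sub, he, map_zero]
    have hd' : (C d : ℂ⟦X⟧) = C a * m := by rw [hd, map_mul, map_natCast]
    have hp : derivative ℂ (C (coeff m b) * (X + C e * b) ^ m) =
        C (coeff m b) * ((m : ℂ⟦X⟧) * (X + C e * b) ^ (m - 1) * (1 + C e * derivative ℂ b)) := by
      simp only [Derivation.leibniz, Derivation.leibniz_pow, nsmul_eq_mul, smul_eq_mul,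
        derivative_C, derivative_X, map_add]
      ring
    have hpow : (X + C e * b) ^ m = (X + C e * b) ^ (m - 1) * (X + C e * b) := by
      rw [← pow_succ, Nat.sub_add_cancel (by omega)]
    rw [map_sub, hp, hpow]
    refine ⟨w - C (coeff m b) * (m : ℂ⟦X⟧) * (X + C e * b) ^ (m - 1) * C e * w, ?_⟩
    linear_combination (1 - C (coeff m b) * m * (X + C e * b) ^ (m - 1) * C e) * hw
      - C (coeff m b) * m * (X + C e * b) ^ (m - 1) * b * he'
      + C (coeff m b) * (X + C e * b) ^ (m - 1) * (X + C e * b) * hd'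

end EulerField

section Coordinates

open PowerSeries

/-- The `k`-th coordinate (0-indexed) on `ℂ^n`; zero if `k` is out of range. -/
noncomputable def coord (n k : ℕ) : (Fin n → ℂ) →ₗ[ℂ] ℂ :=
  if h : k < n then LinearMap.proj ⟨k, h⟩ else 0

/-- The power series `∑ aₖ Xᵏ`, truncated at order `n - 1`, as the vector
`a₀ e₁ + a₁ e₃ + a₂ e₄ + ⋯ + a_{n-2} eₙ`. -/
noncomputable def ofSeries (n : ℕ) : ℂ⟦X⟧ →ₗ[ℂ] (Fin n → ℂ) :=
  LinearMap.pi fun i => if i.1 = 0 then coeff 0 else if i.1 = 1 then 0 else coeff (i.1 - 1)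

/-- The polynomial corresponding to a vector under `ofSeries`, forgetting the `e₂` component. -/
noncomputable def toSeries (n : ℕ) : (Fin n → ℂ) →ₗ[ℂ] ℂ⟦X⟧ where
  toFun u := PowerSeries.mk fun k => if k = 0 then coord n 0 u else coord n (k + 1) u
  map_add' u v := by ext k; simp only [coeff_mk, map_add]; split_ifs <;> rfl
  map_smul' c u := by
    ext k; simp only [coeff_mk, map_smul, RingHom.id_apply]; split_ifs <;> rfl

variable {n : ℕ}

lemma coord_of_lt {k : ℕ} (h : k < n) (u : Fin n → ℂ) : coord n k u = u ⟨k, h⟩ := by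
  simp [coord, h]

lemma coord_of_le {k : ℕ} (h : n ≤ k) (u : Fin n → ℂ) : coord n k u = 0 := by
  simp [coord, h.not_gt]

lemma coord_E {k t : ℕ} (ht : 1 ≤ t) (htn : t ≤ n) :
    coord n k (E n t) = if t = k + 1 then 1 else 0 := by
  by_cases hk : k < n
  · rw [coord_of_lt hk, E, dif_pos ⟨ht, htn⟩, Pi.single_apply]
    congr 1
    simp only [Fin.mk.injEq, eq_iff_iff]
    omega
  · rw [coord_of_le (by omega), if_neg (by omega)]

lemma E_of_lt {t : ℕ} (h : n < t) : E n t = 0 := by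
  rw [E, dif_neg (by omega)]

lemma E_succ (i : Fin n) : E n (i.1 + 1) = Pi.single i 1 := by
  rw [E, dif_pos ⟨by omega, by omega⟩]
  rfl

lemma coord_ofSeries_zero (hn : 0 < n) (f : ℂ⟦X⟧) : coord n 0 (ofSeries n f) = coeff 0 f := by
  simp [coord_of_lt hn, ofSeries]

lemma coord_ofSeries_one (f : ℂ⟦X⟧) : coord n 1 (ofSeries n f) = 0 := by
  by_cases h : 1 < n
  · simp [coord_of_lt h, ofSeries]
  · exact coord_of_le (by omega) _

lemma coord_ofSeries_succ {k : ℕ} (hk : 1 ≤ k) (hkn : k + 1 < n) (f : ℂ⟦X⟧) :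
    coord n (k + 1) (ofSeries n f) = coeff k f := by
  simp [coord_of_lt hkn, ofSeries, show k ≠ 0 by omega]

lemma ext_coord {u v : Fin n → ℂ} (h : ∀ k < n, coord n k u = coord n k v) : u = v := by
  ext ⟨k, hk⟩
  simpa [coord_of_lt hk] using h k hk

lemma ofSeries_eq_zero_iff (hn : 2 ≤ n) {f : ℂ⟦X⟧} :
    ofSeries n f = 0 ↔ X ^ (n - 1) ∣ f := by
  rw [X_pow_dvd_iff]
  constructor
  · intro h k hk
    rcases Nat.eq_zero_or_pos k with rfl | hk0
    · rw [← coord_ofSeries_zero (n := n) (by omega), h, map_zero]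
    · rw [← coord_ofSeries_succ (n := n) hk0 (by omega), h, map_zero]
  · intro h
    refine ext_coord fun k hk => ?_
    rw [map_zero]
    rcases k with _ | _ | k
    · rw [coord_ofSeries_zero hk]; exact h 0 (by omega)
    · exact coord_ofSeries_one f
    · rw [coord_ofSeries_succ (by omega) hk]; exact h _ (by omega)

lemma ofSeries_eq_iff (hn : 2 ≤ n) {f g : ℂ⟦X⟧} :
    ofSeries n f = ofSeries n g ↔ X ^ (n - 1) ∣ f - g := by
  rw [← ofSeries_eq_zero_iff hn, map_sub, sub_eq_zero]

lemma toSeries_ofSeries (hn : 2 ≤ n) (f : ℂ⟦X⟧) :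
    X ^ (n - 1) ∣ toSeries n (ofSeries n f) - f := by
  rw [X_pow_dvd_iff]
  intro k hk
  rw [map_sub, sub_eq_zero]
  rcases k with _ | k
  · simp [toSeries, coord_ofSeries_zero (show 0 < n by omega)]
  · simp [toSeries, coord_ofSeries_succ (n := n) (k := k + 1) (by omega) (by omega)]

lemma coeff_toSeries_zero (u : Fin n → ℂ) : coeff 0 (toSeries n u) = coord n 0 u := by
  simp [toSeries]

lemma coeff_toSeries_succ (k : ℕ) (u : Fin n → ℂ) :
    coeff (k + 1) (toSeries n u) = coord n (k + 2) u := by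
  simp [toSeries]

lemma E_one_eq_ofSeries (hn : 1 ≤ n) : E n 1 = ofSeries n 1 := by
  refine ext_coord fun k hk => ?_
  rw [coord_E le_rfl hn]
  rcases k with _ | _ | k
  · simp [coord_ofSeries_zero hn]
  · simp [coord_ofSeries_one]
  · rw [coord_ofSeries_succ (by omega) hk]; simp [coeff_one]

lemma E_eq_ofSeries {t : ℕ} (ht : 3 ≤ t) : E n t = ofSeries n (X ^ (t - 2)) := by
  by_cases htn : t ≤ n
  · refine ext_coord fun k hk => ?_
    rw [coord_E (by omega) htn]
    rcases k with _ | _ | k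
    · rw [coord_ofSeries_zero hk, coeff_X_pow, if_neg (by omega), if_neg (by omega)]
    · rw [coord_ofSeries_one, if_neg (by omega)]
    · rw [coord_ofSeries_succ (by omega) hk, coeff_X_pow]
      congr 1
      simp only [eq_iff_iff]
      omega
  · rw [E_of_lt (by omega)]
    by_cases hn : 2 ≤ n
    · exact ((ofSeries_eq_zero_iff hn).2 (pow_dvd_pow X (by omega))).symm
    · refine ext_coord fun k hk => ?_
      obtain rfl : k = 0 := by omega
      rw [coord_ofSeries_zero hk, coeff_X_pow, if_neg (by omega), map_zero]

lemma toSeries_E_one (hn : 1 ≤ n) : toSeries n (E n 1) = 1 := by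
  ext k
  rcases k with _ | k
  · rw [coeff_toSeries_zero, coord_E le_rfl hn]; simp
  · rw [coeff_toSeries_succ, coord_E le_rfl hn]; simp [coeff_one]

lemma toSeries_E_two (hn : 2 ≤ n) : toSeries n (E n 2) = 0 := by
  ext k
  rcases k with _ | k
  · rw [coeff_toSeries_zero, coord_E (by omega) hn]; simp
  · rw [coeff_toSeries_succ, coord_E (by omega) hn]; simp

lemma toSeries_E {t : ℕ} (ht : 3 ≤ t) (htn : t ≤ n) : toSeries n (E n t) = X ^ (t - 2) := by
  ext k
  rcases k with _ | k
  · rw [coeff_toSeries_zero, coord_E (by omega) htn, coeff_X_pow, if_neg (by omega),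
      if_neg (by omega)]
  · rw [coeff_toSeries_succ, coord_E (by omega) htn, coeff_X_pow]
    congr 1
    simp only [eq_iff_iff]
    omega

end Coordinates

section Bracket

open PowerSeries

variable {n : ℕ}

/-- The series `∑_{t=4}^n β_t y^{t-2}`; for `y = X`, multiplication by it is the right
multiplication by `e₂`. -/
noncomputable def betaSeries (n : ℕ) (β : ℕ → ℂ) (y : ℂ⟦X⟧) : ℂ⟦X⟧ :=
  ∑ t ∈ Icc 4 n, C (β t) * y ^ (t - 2)

/-- The series by which the right multiplication by a vector acts. -/
noncomputable def rightSeries (n : ℕ) (b : ℂ⟦X⟧) : (Fin n → ℂ) →ₗ[ℂ] ℂ⟦X⟧ :=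
  (coord n 0).smulRight X + (coord n 1).smulRight b

/-- The bracket of the second family in terms of power series. -/
noncomputable def seriesBracket (n : ℕ) (b : ℂ⟦X⟧) (γ : ℂ) :
    (Fin n → ℂ) →ₗ[ℂ] (Fin n → ℂ) →ₗ[ℂ] (Fin n → ℂ) :=
  ((LinearMap.mul ℂ ℂ⟦X⟧).compl₁₂ (toSeries n) (rightSeries n b)).compr₂ (ofSeries n) +
    ((LinearMap.mul ℂ ℂ).compl₁₂ (coord n 1) (coord n 1)).compr₂
      (LinearMap.toSpanSingleton ℂ _ (γ • ofSeries n (X ^ (n - 2))))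

lemma rightSeries_apply (b : ℂ⟦X⟧) (u : Fin n → ℂ) :
    rightSeries n b u = C (coord n 0 u) * X + C (coord n 1 u) * b := by
  simp [rightSeries, smul_eq_C_mul]

lemma seriesBracket_apply (b : ℂ⟦X⟧) (γ : ℂ) (u v : Fin n → ℂ) :
    seriesBracket n b γ u v = ofSeries n (toSeries n u * rightSeries n b v) +
      (coord n 1 u * coord n 1 v * γ) • ofSeries n (X ^ (n - 2)) := by
  simp [seriesBracket, smul_smul]

lemma bracketOf_eq_of_basis {V : Type*} [AddCommGroup V] [Module ℂ V]
    {m : ℕ → ℕ → Fin n → ℂ} (φ : (Fin n → ℂ) →ₗ[ℂ] V)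
    (F : (Fin n → ℂ) →ₗ[ℂ] (Fin n → ℂ) →ₗ[ℂ] V)
    (h : ∀ i j, 1 ≤ i → i ≤ n → 1 ≤ j → j ≤ n → φ (m i j) = F (E n i) (E n j))
    (x y : Fin n → ℂ) : φ (bracketOf n m x y) = F x y := by
  have hx : ∀ x : Fin n → ℂ, x = ∑ i, x i • E n (i.1 + 1) := fun x => by
    simp_rw [E_succ]
    exact pi_eq_sum_univ' x
  conv_rhs => rw [hx x, hx y]
  simp only [bracketOf, map_sum, map_smul, LinearMap.sum_apply, LinearMap.smul_apply,
    Finset.smul_sum, smul_smul]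
  rw [Finset.sum_comm]
  refine Finset.sum_congr rfl fun j _ => Finset.sum_congr rfl fun i _ => ?_
  rw [h _ _ (by omega) (by omega) (by omega) (by omega), mul_comm]

lemma ofSeries_mul_betaSeries (hn : 2 ≤ n) (β : ℕ → ℂ) {y : ℂ⟦X⟧} (hy : X ∣ y) (k : ℕ) :
    ofSeries n (y ^ k * betaSeries n β y) =
      ∑ t ∈ Icc (4 + k) n, β (t - k) • ofSeries n (y ^ (t - 2)) := by
  have h1 : ofSeries n (y ^ k * betaSeries n β y) =
      ∑ t ∈ Icc 4 n, β t • ofSeries n (y ^ (t + k - 2)) := by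
    rw [betaSeries, Finset.mul_sum, map_sum]
    refine Finset.sum_congr rfl fun t ht => ?_
    rw [Finset.mem_Icc] at ht
    rw [← map_smul, smul_eq_C_mul, show t + k - 2 = k + (t - 2) by omega, pow_add]
    congr 1
    ring
  have h2 : ∑ t ∈ Icc (4 + k) (n + k), β (t - k) • ofSeries n (y ^ (t - 2)) =
      ∑ t ∈ Icc 4 n, β t • ofSeries n (y ^ (t + k - 2)) := by
    rw [← Finset.map_add_right_Icc, Finset.sum_map]
    simp
  rw [h1, ← h2]
  symm
  apply Finset.sum_subset (Finset.Icc_subset_Icc_right (by omega))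
  intro t ht ht'
  rw [Finset.mem_Icc] at ht ht'
  rw [(ofSeries_eq_zero_iff hn).2, smul_zero]
  exact (pow_dvd_pow X (by omega)).trans (pow_dvd_pow_of_dvd hy _)

lemma rightSeries_E_one (hn : 1 ≤ n) (b : ℂ⟦X⟧) : rightSeries n b (E n 1) = X := by
  simp [rightSeries_apply, coord_E le_rfl hn]

lemma rightSeries_E_two (hn : 2 ≤ n) (b : ℂ⟦X⟧) : rightSeries n b (E n 2) = b := by
  simp [rightSeries_apply, coord_E (show 1 ≤ 2 by omega) hn]

lemma rightSeries_ofSeries (hn : 1 ≤ n) (b f : ℂ⟦X⟧) :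
    rightSeries n b (ofSeries n f) = C (coeff 0 f) * X := by
  rw [rightSeries_apply, coord_ofSeries_zero hn, coord_ofSeries_one]
  simp

lemma X_sq_dvd_betaSeries (β : ℕ → ℂ) : X ^ 2 ∣ betaSeries n β X :=
  Finset.dvd_sum fun t ht =>
    dvd_mul_of_dvd_right (pow_dvd_pow X (by rw [Finset.mem_Icc] at ht; omega)) _

lemma coeff_betaSeries (β : ℕ → ℂ) {k : ℕ} (hk : 2 ≤ k) (hkn : k + 2 ≤ n) :
    coeff k (betaSeries n β X) = β (k + 2) := by
  rw [betaSeries, map_sum, Finset.sum_eq_single (k + 2)]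
  · simp
  · intro t ht htk
    rw [Finset.mem_Icc] at ht
    rw [coeff_C_mul_X_pow, if_neg (by omega)]
  · intro h
    exact absurd (Finset.mem_Icc.2 ⟨by omega, hkn⟩) h

/-- Transporting the multiplication table of the second family along a linear map
given on the basis. -/
lemma map_F2mul {V : Type*} [AddCommGroup V] [Module ℂ V] (φ : (Fin n → ℂ) →ₗ[ℂ] V)
    (F : (Fin n → ℂ) →ₗ[ℂ] (Fin n → ℂ) →ₗ[ℂ] V) {β : ℕ → ℂ} {γ : ℂ}
    (h11 : φ (E n 3) = F (E n 1) (E n 1))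
    (h21 : 0 = F (E n 2) (E n 1))
    (hi1 : ∀ i, 3 ≤ i → i ≤ n → φ (E n (i + 1)) = F (E n i) (E n 1))
    (h12 : ∑ t ∈ Icc 4 n, β t • φ (E n t) = F (E n 1) (E n 2))
    (h22 : γ • φ (E n n) = F (E n 2) (E n 2))
    (hi2 : ∀ i, 3 ≤ i → i ≤ n →
      ∑ t ∈ Icc (i + 2) n, β (t - i + 2) • φ (E n t) = F (E n i) (E n 2))
    (hj : ∀ i j, 1 ≤ i → i ≤ n → 3 ≤ j → j ≤ n → F (E n i) (E n j) = 0)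
    (x y : Fin n → ℂ) : φ (bracketOf n (F2mul n β γ) x y) = F x y := by
  refine bracketOf_eq_of_basis φ F (fun i j hi hin hj1 hjn => ?_) x y
  obtain rfl | rfl | hj3 : j = 1 ∨ j = 2 ∨ 3 ≤ j := by omega
  · obtain rfl | rfl | hi3 : i = 1 ∨ i = 2 ∨ 3 ≤ i := by omega
    · simpa [F2mul] using h11
    · simpa [F2mul] using h21
    · rw [← hi1 i hi3 hin]
      by_cases h : i ≤ n - 1
      · simp [F2mul, hi3, h, show i ≠ 1 by omega]
      · rw [E_of_lt (by omega)]
        simp [F2mul, show i ≠ 1 by omega, h]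
  · obtain rfl | rfl | hi3 : i = 1 ∨ i = 2 ∨ 3 ≤ i := by omega
    · simpa [F2mul] using h12
    · simpa [F2mul] using h22
    · rw [← hi2 i hi3 hin]
      by_cases h : i ≤ n - 2
      · simp [F2mul, hi3, h, show i ≠ 1 by omega, show i ≠ 2 by omega]
      · rw [Finset.Icc_eq_empty (by omega)]
        simp [F2mul, show i ≠ 1 by omega, show i ≠ 2 by omega, h]
  · rw [hj i j hi hin hj3 hjn]
    simp [F2mul, show j ≠ 1 by omega, show j ≠ 2 by omega]

lemma bracketOf_F2mul (hn : 3 ≤ n) (β : ℕ → ℂ) (γ : ℂ) (x y : Fin n → ℂ) :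
    bracketOf n (F2mul n β γ) x y = seriesBracket n (betaSeries n β X) γ x y := by
  have hc : ∀ i, 1 ≤ i → i ≤ n → coord n 1 (E n i) = if i = 2 then 1 else 0 :=
    fun i hi hin => coord_E hi hin
  have hb := ofSeries_mul_betaSeries (show 2 ≤ n by omega) β (dvd_refl (X : ℂ⟦X⟧))
  refine map_F2mul LinearMap.id _ ?_ ?_ ?_ ?_ ?_ ?_ ?_ x y
  · rw [seriesBracket_apply, hc 1 le_rfl (by omega), toSeries_E_one (by omega),
      rightSeries_E_one (by omega), E_eq_ofSeries le_rfl]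
    simp
  · rw [seriesBracket_apply, hc 1 le_rfl (by omega), toSeries_E_two (by omega)]
    simp
  · intro i hi hin
    rw [seriesBracket_apply, hc 1 le_rfl (by omega), toSeries_E hi hin,
      rightSeries_E_one (by omega), E_eq_ofSeries (by omega), ← pow_succ,
      show i + 1 - 2 = i - 2 + 1 by omega]
    simp
  · rw [seriesBracket_apply, hc 1 le_rfl (by omega), toSeries_E_one (by omega),
      rightSeries_E_two (by omega), ← pow_zero X, hb]
    simp only [OfNat.one_ne_ofNat, if_false, zero_mul, zero_smul, add_zero]
    refine Finset.sum_congr rfl fun t ht => ?_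
    rw [Finset.mem_Icc] at ht
    rw [E_eq_ofSeries (by omega)]
    rfl
  · rw [seriesBracket_apply, hc 2 (by omega) (by omega), toSeries_E_two (by omega),
      E_eq_ofSeries (by omega)]
    simp
  · intro i hi hin
    rw [seriesBracket_apply, hc i (by omega) hin, toSeries_E hi hin,
      rightSeries_E_two (by omega), hb, if_neg (by omega), show 4 + (i - 2) = i + 2 by omega]
    simp only [zero_mul, zero_smul, add_zero]
    refine Finset.sum_congr rfl fun t ht => ?_
    rw [Finset.mem_Icc] at ht
    rw [E_eq_ofSeries (by omega), show t - (i - 2) = t - i + 2 by omega]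
    rfl
  · intro i j hi hin hj hjn
    rw [seriesBracket_apply, hc j (by omega) hjn, if_neg (by omega), E_eq_ofSeries hj,
      rightSeries_ofSeries (by omega), coeff_X_pow, if_neg (by omega)]
    simp

end Bracket

section BaseChange

open PowerSeries

variable {n : ℕ}

/-- The images of the basis vectors under the base change
`e₁ ↦ e₁ + ε e₂`, `e₂ ↦ μ (e₂ - ε γ e_{n-1})`. -/
noncomputable def baseChangeVec (n : ℕ) (y : ℂ⟦X⟧) (ε γ μ : ℂ) (t : ℕ) : Fin n → ℂ :=
  if t = 1 then E n 1 + ε • E n 2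
  else if t = 2 then μ • (E n 2 - (ε * γ) • ofSeries n (X ^ (n - 3)))
  else if t = 3 then ofSeries n y + (ε ^ 2 * γ) • ofSeries n (X ^ (n - 2))
  else ofSeries n (y ^ (t - 2))

lemma exists_linearEquiv_of_triangular (f : ℕ → Fin n → ℂ)
    (h0 : ∀ t k, 1 ≤ t → t ≤ n → k + 1 < t → coord n k (f t) = 0)
    (h1 : ∀ t, 1 ≤ t → t ≤ n → coord n (t - 1) (f t) ≠ 0) :
    ∃ φ : (Fin n → ℂ) ≃ₗ[ℂ] (Fin n → ℂ), ∀ t, 1 ≤ t → t ≤ n → φ (E n t) = f t := by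
  let φ := Fintype.linearCombination ℂ (fun i : Fin n => f (i.1 + 1))
  have hφ : ∀ u, φ u = ∑ i, u i • f (i.1 + 1) := fun u => rfl
  have hinj : Function.Injective φ := by
    rw [← LinearMap.ker_eq_bot, LinearMap.ker_eq_bot']
    intro u hu
    have key : ∀ k, ∀ h : k < n, u ⟨k, h⟩ = 0 := by
      intro k
      induction k using Nat.strong_induction_on with
      | _ k ih =>
        intro hk
        have := congrArg (coord n k) hu
        rw [hφ, map_sum, map_zero, Finset.sum_eq_single (⟨k, hk⟩ : Fin n)] at this
        · rw [map_smul, smul_eq_mul] at this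
          exact (mul_eq_zero.1 this).resolve_right (h1 (k + 1) (by omega) (by omega))
        · rintro ⟨j, hj⟩ - hne
          have hne' : j ≠ k := fun h => hne (Fin.ext h)
          rcases lt_or_gt_of_ne hne' with h | h
          · rw [ih j h hj, zero_smul, map_zero]
          · rw [map_smul, h0 _ _ (by omega) (by omega) (by simpa using h), smul_zero]
        · simp
    ext ⟨k, hk⟩
    exact key k hk
  refine ⟨LinearEquiv.ofInjectiveEndo φ hinj, fun t ht htn => ?_⟩
  obtain ⟨k, rfl⟩ : ∃ k, t = k + 1 := ⟨t - 1, by omega⟩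
  have hE : E n (k + 1) = Pi.single (⟨k, by omega⟩ : Fin n) 1 := E_succ ⟨k, by omega⟩
  rw [LinearEquiv.coe_ofInjectiveEndo, hE]
  simp [φ, Fintype.linearCombination_apply_single]

/-- The base change `y = X + ε b` identifies `F2(β', μ² γ)` with the second family algebra of
`b`, when `β'` is the expansion of `μ (b + ε γ X^{n-2})` in powers of `y`. -/
theorem exists_linearEquiv_seriesBracket (hn : 5 ≤ n) {b y v : ℂ⟦X⟧} {ε γ μ : ℂ} {β' : ℕ → ℂ}
    (hb : X ^ 2 ∣ b) (hyb : y = X + C ε * b) (hy : y = X * (1 + X * v)) (hμ : μ ≠ 0)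
    (hβ : X ^ (n - 1) ∣ betaSeries n β' y - C μ * (b + C (ε * γ) * X ^ (n - 2))) :
    ∃ φ : (Fin n → ℂ) ≃ₗ[ℂ] (Fin n → ℂ), ∀ x z,
      φ (bracketOf n (F2mul n β' (μ ^ 2 * γ)) x z) = seriesBracket n b γ (φ x) (φ z) := by
  have hXy : X ∣ y := ⟨_, hy⟩
  have hcoeff : ∀ m, coeff m (y ^ m) = 1 := fun m => by
    have := coeff_X_pow_mul ((1 + X * v) ^ m) m 0
    rw [zero_add] at this
    rw [hy, mul_pow, this]
    simp
  have hypow : ∀ m k, k < m → coeff k (y ^ m) = 0 := fun m k hk =>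
    X_pow_dvd_iff.1 (pow_dvd_pow_of_dvd hXy m) k hk
  have hX : ∀ k, n - 1 ≤ k → ofSeries n (X ^ k) = 0 := fun k hk =>
    (ofSeries_eq_zero_iff (by omega)).2 (pow_dvd_pow X hk)
  set f := baseChangeVec n y ε γ μ with hf
  have f1 : f 1 = E n 1 + ε • E n 2 := by simp [hf, baseChangeVec]
  have f2 : f 2 = μ • (E n 2 - (ε * γ) • ofSeries n (X ^ (n - 3))) := by
    simp [hf, baseChangeVec]
  have f3 : f 3 = ofSeries n y + (ε ^ 2 * γ) • ofSeries n (X ^ (n - 2)) := by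
    simp [hf, baseChangeVec]
  have f4 : ∀ t, 4 ≤ t → f t = ofSeries n (y ^ (t - 2)) := fun t ht => by
    simp [hf, baseChangeVec, show t ≠ 1 by omega, show t ≠ 2 by omega, show t ≠ 3 by omega]
  have f3' : f 3 = ofSeries n (y + C (ε ^ 2 * γ) * X ^ (n - 2)) := by
    rw [f3, map_add, ← smul_eq_C_mul, map_smul]
  obtain ⟨φ, hφ⟩ := exists_linearEquiv_of_triangular f (by
    intro t k ht htn hk
    obtain rfl | rfl | rfl | ht4 : t = 1 ∨ t = 2 ∨ t = 3 ∨ 4 ≤ t := by omega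
    · omega
    · obtain rfl : k = 0 := by omega
      rw [f2, map_smul, map_sub, map_smul, coord_ofSeries_zero (by omega),
        coord_E (by omega) htn, coeff_X_pow, if_neg (by omega), if_neg (by omega)]
      simp
    · rw [f3']
      obtain rfl | rfl : k = 0 ∨ k = 1 := by omega
      · rw [coord_ofSeries_zero (by omega), map_add, coeff_C_mul_X_pow, if_neg (by omega),
          ← pow_one y, hypow 1 0 one_pos, add_zero]
      · exact coord_ofSeries_one _
    · rw [f4 t ht4]
      rcases k with _ | _ | k
      · rw [coord_ofSeries_zero (by omega), hypow _ _ (by omega)]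
      · exact coord_ofSeries_one _
      · rw [coord_ofSeries_succ (by omega) (by omega), hypow _ _ (by omega)]) (by
    intro t ht htn
    obtain rfl | rfl | rfl | ht4 : t = 1 ∨ t = 2 ∨ t = 3 ∨ 4 ≤ t := by omega
    · rw [f1, map_add, map_smul, coord_E le_rfl htn, coord_E (by omega) (by omega)]
      simp
    · rw [f2, map_smul, map_sub, map_smul, coord_ofSeries_one, coord_E (by omega) htn]
      simpa using hμ
    · rw [f3', coord_ofSeries_succ (by omega) (by omega), map_add, coeff_C_mul_X_pow,
        if_neg (by omega)]
      have := hcoeff 1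
      rw [pow_one] at this
      rw [this]
      simp
    · rw [f4 t ht4, show t - 1 = t - 2 + 1 by omega,
        coord_ofSeries_succ (by omega) (by omega), hcoeff]
      exact one_ne_zero)
  have hφ' : ∀ t, 4 ≤ t → φ (E n t) = ofSeries n (y ^ (t - 2)) := fun t ht => by
    by_cases htn : t ≤ n
    · rw [hφ t (by omega) htn, f4 t ht]
    · rw [E_of_lt (by omega), map_zero]
      exact ((ofSeries_eq_zero_iff (by omega)).2
        ((pow_dvd_pow X (by omega)).trans (pow_dvd_pow_of_dvd hXy _))).symm
  have hsum : ∀ k, ofSeries n (y ^ k * (C μ * (b + C (ε * γ) * X ^ (n - 2)))) =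
      ∑ t ∈ Icc (4 + k) n, β' (t - k) • φ (E n t) := fun k => by
    rw [Finset.sum_congr rfl fun t ht => by
        rw [hφ' t (by rw [Finset.mem_Icc] at ht; omega)],
      ← ofSeries_mul_betaSeries (by omega) β' hXy k, eq_comm, ofSeries_eq_iff (by omega),
      ← mul_sub]
    exact dvd_mul_of_dvd_right hβ _
  -- coordinates of the new basis vectors
  have c1 : coord n 1 (f 1) = ε := by
    rw [f1, map_add, map_smul, coord_E le_rfl (by omega), coord_E (by omega) (by omega)]
    simp
  have c2 : coord n 1 (f 2) = μ := by
    rw [f2, map_smul, map_sub, map_smul, coord_ofSeries_one, coord_E (by omega) (by omega)]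
    simp
  have r1 : rightSeries n b (f 1) = y := by
    rw [f1, map_add, map_smul, rightSeries_E_one (by omega), rightSeries_E_two (by omega),
      smul_eq_C_mul, hyb]
  have r2 : rightSeries n b (f 2) = C μ * b := by
    rw [f2, map_smul, map_sub, map_smul, rightSeries_E_two (by omega),
      rightSeries_ofSeries (by omega), coeff_X_pow, if_neg (by omega), smul_eq_C_mul]
    simp
  have s1 : toSeries n (f 1) = 1 := by
    rw [f1, map_add, map_smul, toSeries_E_one (by omega), toSeries_E_two (by omega)]
    simp
  have hts : ∀ g w : ℂ⟦X⟧, ofSeries n (toSeries n (ofSeries n g) * w) = ofSeries n (g * w) := by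
    intro g w
    rw [ofSeries_eq_iff (by omega), ← sub_mul]
    exact dvd_mul_of_dvd_left (toSeries_ofSeries (by omega) g) w
  have hs2 : ∀ w : ℂ⟦X⟧, ofSeries n (toSeries n (f 2) * w) =
      -(μ * (ε * γ)) • ofSeries n (X ^ (n - 3) * w) := by
    intro w
    rw [f2, map_smul, map_sub, map_smul, toSeries_E_two (by omega), zero_sub, smul_neg,
      smul_smul, neg_mul, smul_mul_assoc, map_neg, map_smul, hts, neg_smul]
  have hfi : ∀ i, 3 ≤ i → ∃ g, f i = ofSeries n g ∧ coeff 0 g = 0 ∧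
      (∀ w, X ∣ w → X ^ (n - 1) ∣ g * w - y ^ (i - 2) * w) := by
    intro i hi
    obtain rfl | hi4 : i = 3 ∨ 4 ≤ i := by omega
    · refine ⟨_, f3', ?_, ?_⟩
      · rw [map_add, coeff_C_mul_X_pow, if_neg (by omega), ← pow_one y, hypow 1 0 one_pos,
          add_zero]
      · rintro w ⟨w, rfl⟩
        refine ⟨C (ε ^ 2 * γ) * w, ?_⟩
        rw [show n - 1 = n - 2 + 1 by omega]
        ring
    · refine ⟨_, f4 i hi4, hypow _ _ (by omega), ?_⟩
      simp
  have hi1 : ∀ i, 3 ≤ i → ∀ w, X ∣ w →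
      ofSeries n (toSeries n (f i) * w) = ofSeries n (y ^ (i - 2) * w) := by
    intro i hi w hw
    obtain ⟨g, hg, -, hgw⟩ := hfi i hi
    rw [hg, hts, ofSeries_eq_iff (by omega)]
    exact hgw w hw
  have ci : ∀ i, 3 ≤ i → coord n 1 (f i) = 0 := by
    intro i hi
    obtain ⟨g, hg, -⟩ := hfi i hi
    rw [hg, coord_ofSeries_one]
  have ri : ∀ i, 3 ≤ i → rightSeries n b (f i) = 0 := by
    intro i hi
    obtain ⟨g, hg, hg0, -⟩ := hfi i hi
    rw [hg, rightSeries_ofSeries (by omega), hg0]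
    simp
  have hXb : X ∣ b := (dvd_pow_self X two_ne_zero).trans hb
  refine ⟨φ, map_F2mul φ.toLinearMap ((seriesBracket n b γ).compl₁₂ φ.toLinearMap φ.toLinearMap)
    ?_ ?_ ?_ ?_ ?_ ?_ ?_⟩
  all_goals simp only [LinearMap.compl₁₂_apply, LinearEquiv.coe_coe, seriesBracket_apply]
  · rw [hφ 1 le_rfl (by omega), hφ 3 (by omega) (by omega), s1, r1, c1, one_mul, f3, sq]
  · rw [hφ 1 le_rfl (by omega), hφ 2 (by omega) (by omega), hs2, r1, c1, c2]
    have : ofSeries n (X ^ (n - 3) * y) = ofSeries n (X ^ (n - 2)) := by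
      rw [ofSeries_eq_iff (by omega), hy]
      refine ⟨v, ?_⟩
      rw [show n - 1 = n - 3 + 2 by omega, show n - 2 = n - 3 + 1 by omega]
      ring
    rw [this, ← add_smul, show -(μ * (ε * γ)) + μ * ε * γ = 0 by ring, zero_smul]
  · intro i hi hin
    rw [hφ 1 le_rfl (by omega), hφ i (by omega) hin, ci i hi, r1, hi1 i hi y hXy,
      hφ' _ (by omega), ← pow_succ, show i + 1 - 2 = i - 2 + 1 by omega]
    simp
  · have := hsum 0
    rw [pow_zero, one_mul] at this
    simp only [add_zero, Nat.sub_zero] at this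
    rw [← this, hφ 1 le_rfl (by omega), hφ 2 (by omega) (by omega), s1, r2, c1, c2, mul_add,
      map_add, one_mul, show C μ * (C (ε * γ) * X ^ (n - 2)) =
        (ε * μ * γ) • (X : ℂ⟦X⟧) ^ (n - 2) by simp [smul_eq_C_mul]; ring, map_smul]
  · rw [hφ 2 (by omega) (by omega), hφ' n (by omega), hs2, r2, c2]
    have e1 : ofSeries n (X ^ (n - 3) * (C μ * b)) = 0 := by
      obtain ⟨s, rfl⟩ := hb
      refine (ofSeries_eq_zero_iff (by omega)).2 ⟨C μ * s, ?_⟩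
      rw [show n - 1 = n - 3 + 2 by omega]
      ring
    have e2 : ofSeries n (y ^ (n - 2)) = ofSeries n (X ^ (n - 2)) := by
      have h := X_pow_succ_dvd_sub (j := n - 2) hy (dvd_refl (X ^ (n - 2)))
      rw [coeff_X_pow_self, map_one, one_mul, show n - 2 + 1 = n - 1 by omega] at h
      exact ((ofSeries_eq_iff (by omega)).2 h).symm
    rw [e1, e2, smul_zero, zero_add, sq]
  · intro i hi hin
    rw [hφ 2 (by omega) (by omega), hφ i (by omega) hin, ci i hi, r2,
      hi1 i hi _ (dvd_mul_of_dvd_right hXb _)]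
    have hs := hsum (i - 2)
    have e1 : ofSeries n (y ^ (i - 2) * (C μ * (b + C (ε * γ) * X ^ (n - 2)))) =
        ofSeries n (y ^ (i - 2) * (C μ * b)) := by
      rw [ofSeries_eq_iff (by omega)]
      refine ⟨C μ * C (ε * γ) * (1 + X * v) * y ^ (i - 3), ?_⟩
      rw [show n - 1 = n - 2 + 1 by omega, show i - 2 = i - 3 + 1 by omega]
      linear_combination C μ * C (ε * γ) * X ^ (n - 2) * y ^ (i - 3) * hy
    rw [← e1, hs, zero_mul, zero_mul, zero_smul, add_zero, show 4 + (i - 2) = i + 2 by omega]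
    refine Finset.sum_congr rfl fun t ht => ?_
    rw [Finset.mem_Icc] at ht
    rw [show t - (i - 2) = t - i + 2 by omega]
  · intro i j hi hin hj hjn
    rw [hφ j (by omega) hjn, ci j hj, ri j hj]
    simp

end BaseChange

section PreDerivation

open PowerSeries

variable {n : ℕ}

lemma isNilpotent_of_strictly_triangular (P : Module.End ℂ (Fin n → ℂ))
    (h : ∀ t, 1 ≤ t → t ≤ n → ∀ k < t, coord n k (P (E n t)) = 0) : IsNilpotent P := by
  have hstep : ∀ k, ∀ u : Fin n → ℂ, (∀ i < k, coord n i u = 0) →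
      ∀ i < k + 1, coord n i (P u) = 0 := by
    intro k u hu i hi
    have hPu : P u = ∑ j, u j • P (E n (j.1 + 1)) := by
      conv_lhs => rw [pi_eq_sum_univ' u]
      simp only [map_sum, map_smul, E_succ]
    rw [hPu, map_sum]
    refine Finset.sum_eq_zero fun j _ => ?_
    rw [map_smul]
    by_cases hj : j.1 < k
    · have := hu j hj
      rw [coord_of_lt j.2] at this
      rw [this, zero_smul]
    · rw [h _ (by omega) (by omega) i (by omega), smul_zero]
  have hpow : ∀ k, ∀ u : Fin n → ℂ, ∀ i < k, coord n i ((P ^ k) u) = 0 := by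
    intro k
    induction k with
    | zero => intro u i hi; omega
    | succ k ih =>
      intro u i hi
      rw [pow_succ', Module.End.mul_apply]
      exact hstep k _ (ih u) i hi
  refine ⟨n, LinearMap.ext fun u => ext_coord fun k hk => ?_⟩
  rw [hpow n u k hk, LinearMap.zero_apply, map_zero]

lemma seriesBracket_seriesBracket (hn : 3 ≤ n) {b : ℂ⟦X⟧} (hb : X ∣ b) (γ : ℂ)
    (u v w : Fin n → ℂ) :
    seriesBracket n b γ (seriesBracket n b γ u v) w =
      ofSeries n (toSeries n u * rightSeries n b v * rightSeries n b w) := by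
  have hw : X ∣ rightSeries n b w := by
    rw [rightSeries_apply]
    exact dvd_add (dvd_mul_left _ _) (dvd_mul_of_dvd_right hb _)
  rw [seriesBracket_apply _ _ u v, ← map_smul, ← map_add, seriesBracket_apply,
    coord_ofSeries_one, zero_mul, zero_mul, zero_smul, add_zero, ofSeries_eq_iff (by omega)]
  set g := toSeries n u * rightSeries n b v
  set c := coord n 1 u * coord n 1 v * γ
  obtain ⟨r, hr⟩ := toSeries_ofSeries (n := n) (by omega) (g + c • X ^ (n - 2))
  obtain ⟨s, hs⟩ := hw
  refine ⟨r * rightSeries n b w + C c * s, ?_⟩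
  rw [smul_eq_C_mul] at *
  have hX : (X : ℂ⟦X⟧) ^ (n - 1) = X ^ (n - 2) * X := by
    rw [← pow_succ]; congr 1; omega
  linear_combination rightSeries n b w * hr + C c * X ^ (n - 2) * hs - C c * s * hX

lemma preDeriv_series (hn : 3 ≤ n) {b : ℂ⟦X⟧} (hb : X ∣ b) {γ : ℂ}
    {P : Module.End ℂ (Fin n → ℂ)}
    (hP : IsPreDeriv n (fun x y => seriesBracket n b γ x y) P) (u v w : Fin n → ℂ) :
    P (ofSeries n (toSeries n u * rightSeries n b v * rightSeries n b w)) =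
      ofSeries n (toSeries n (P u) * rightSeries n b v * rightSeries n b w +
        toSeries n u * rightSeries n b (P v) * rightSeries n b w +
        toSeries n u * rightSeries n b v * rightSeries n b (P w)) := by
  have := hP u v w
  simp only [seriesBracket_seriesBracket hn hb] at this
  rw [this, map_add, map_add]

lemma preDeriv_series_dvd (hn : 3 ≤ n) {b : ℂ⟦X⟧} (hb : X ∣ b) {γ : ℂ}
    {P : Module.End ℂ (Fin n → ℂ)}
    (hP : IsPreDeriv n (fun x y => seriesBracket n b γ x y) P) (f : ℂ⟦X⟧) (v w : Fin n → ℂ) :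
    X ^ (n - 1) ∣ toSeries n (P (ofSeries n (f * rightSeries n b v * rightSeries n b w))) -
      (toSeries n (P (ofSeries n f)) * rightSeries n b v * rightSeries n b w +
        f * rightSeries n b (P v) * rightSeries n b w +
        f * rightSeries n b v * rightSeries n b (P w)) := by
  have h := preDeriv_series hn hb hP (ofSeries n f) v w
  have hf : ofSeries n (toSeries n (ofSeries n f) * rightSeries n b v * rightSeries n b w) =
      ofSeries n (f * rightSeries n b v * rightSeries n b w) := by
    rw [ofSeries_eq_iff (by omega), ← sub_mul, ← sub_mul]
    exact dvd_mul_of_dvd_left (dvd_mul_of_dvd_left (toSeries_ofSeries (by omega) f) _) _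
  rw [hf] at h
  rw [h]
  obtain ⟨r, hr⟩ := toSeries_ofSeries (n := n) (by omega)
    (toSeries n (P (ofSeries n f)) * rightSeries n b v * rightSeries n b w +
        toSeries n (ofSeries n f) * rightSeries n b (P v) * rightSeries n b w +
        toSeries n (ofSeries n f) * rightSeries n b v * rightSeries n b (P w))
  obtain ⟨s, hs⟩ := toSeries_ofSeries (n := n) (by omega) f
  refine ⟨r + s * rightSeries n b (P v) * rightSeries n b w +
    s * rightSeries n b v * rightSeries n b (P w), ?_⟩
  linear_combination hr + (rightSeries n b (P v) * rightSeries n b w +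
    rightSeries n b v * rightSeries n b (P w)) * hs

/-- A non-nilpotent pre-derivation makes `b` an eigenvector of a vector field with
non-zero linear part, unless the even part of `b` vanishes. -/
theorem exists_eigenvector_of_preDeriv (hn : 5 ≤ n) {b : ℂ⟦X⟧} (hb : X ^ 2 ∣ b) {γ : ℂ}
    {P : Module.End ℂ (Fin n → ℂ)}
    (hP : IsPreDeriv n (fun x y => seriesBracket n b γ x y) P) (hnil : ¬ IsNilpotent P)
    {k : ℕ} (hk : Even k) (hkn : k < n - 3) (hbk : coeff k b ≠ 0) :
    ∃ a c d : ℂ, a ≠ 0 ∧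
      X ^ (n - 3) ∣ (C a * X + C c * b) * derivative ℂ b - C d * b := by
  have hXb : X ∣ b := (dvd_pow_self X two_ne_zero).trans hb
  have hb' : ¬ X ^ (n - 3) ∣ b := fun h => hbk (X_pow_dvd_iff.1 h k hkn)
  have hrel := preDeriv_series_dvd (n := n) (by omega) hXb hP
  have hX1 : (X : ℂ⟦X⟧) ^ (n - 1) = X ^ (n - 3) * X ^ 2 := by
    rw [← pow_add]; congr 1; omega
  have hX2 : (X : ℂ⟦X⟧) ^ (n - 1) = X ^ (n - 2) * X := by
    rw [← pow_succ]; congr 1; omega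
  have r1 := rightSeries_E_one (n := n) (by omega) b
  have r2 := rightSeries_E_two (n := n) (by omega) b
  -- vectors acting trivially from the right have images acting trivially from the right
  have hker : ∀ v, rightSeries n b v = 0 → coord n 0 (P v) = 0 ∧ coord n 1 (P v) = 0 := by
    intro v hv
    have h := hrel 1 v (E n 1)
    rw [hv, r1] at h
    obtain ⟨w, hw⟩ := h
    have h2 : X ^ (n - 2) ∣ rightSeries n b (P v) := by
      refine ⟨-w, mul_right_cancel₀ X_ne_zero ?_⟩
      simp only [mul_zero, zero_mul, map_zero] at hw
      linear_combination -hw - w * hX2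
    rw [rightSeries_apply] at h2
    have h0 : coord n 0 (P v) = 0 := by
      have := X_pow_dvd_iff.1 h2 1 (by omega)
      rw [map_add, coeff_C_mul, coeff_C_mul, X_pow_dvd_iff.1 hb 1 (by omega)] at this
      simpa using this
    refine ⟨h0, ?_⟩
    rw [h0, map_zero, zero_mul, zero_add] at h2
    have := X_pow_dvd_iff.1 h2 k (by omega)
    rw [coeff_C_mul] at this
    exact (mul_eq_zero.1 this).resolve_right hbk
  set p := toSeries n (P (E n 1)) with hp
  set c := coord n 1 (P (E n 1)) with hc
  set a := coord n 0 (P (E n 1)) with ha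
  set d := coord n 1 (P (E n 2)) with hd
  have hPE1 : rightSeries n b (P (E n 1)) = C a * X + C c * b := rightSeries_apply _ _
  have hd0 : coord n 0 (P (E n 2)) = 0 := by
    have h := preDeriv_series (n := n) (by omega) hXb hP (E n 2) (E n 1) (E n 1)
    rw [toSeries_E_two (by omega), r1] at h
    simp only [zero_mul, map_zero, add_zero] at h
    obtain ⟨w, hw⟩ := (ofSeries_eq_zero_iff (by omega)).1 h.symm
    have h2 : X ^ (n - 3) ∣ toSeries n (P (E n 2)) := by
      refine ⟨w, mul_right_cancel₀ (pow_ne_zero 2 X_ne_zero) ?_⟩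
      linear_combination hw + w * hX1
    rw [← coeff_toSeries_zero]
    exact X_pow_dvd_iff.1 h2 0 (by omega)
  have hPE2 : rightSeries n b (P (E n 2)) = C d * b := by
    rw [rightSeries_apply, hd0]; simp [hd]
  set q := C a * X + C c * b with hq
  -- the part of `P` beyond the first order operator `p + q d/dX`
  let Q : ℂ⟦X⟧ →ₗ[ℂ] ℂ⟦X⟧ := toSeries n ∘ₗ P ∘ₗ ofSeries n
  have hQ : ∀ f, Q f = toSeries n (P (ofSeries n f)) := fun f => rfl
  let R : ℂ⟦X⟧ →ₗ[ℂ] ℂ⟦X⟧ :=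
    Q - LinearMap.mulLeft ℂ p - LinearMap.mulLeft ℂ q ∘ₗ (derivative ℂ).toLinearMap
  have hR : ∀ f, R f = Q f - p * f - q * derivative ℂ f := fun f => rfl
  have hR1 : X ^ (n - 1) ∣ R 1 := by
    rw [hR, hQ, ← E_one_eq_ofSeries (by omega)]
    simp [hp]
  have hR2 : ∀ f, X ^ (n - 1) ∣ R (X ^ 2 * f) - X ^ 2 * R f := by
    intro f
    have h := hrel f (E n 1) (E n 1)
    rw [r1, hPE1, ← hQ, ← hQ, show f * X * X = X ^ 2 * f by ring] at h
    obtain ⟨w, hw⟩ := h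
    refine ⟨w, ?_⟩
    rw [hR, hR, Derivation.leibniz, Derivation.leibniz_pow, derivative_X]
    simp only [smul_eq_mul, nsmul_eq_mul]
    push_cast
    linear_combination hw
  have hRb : ∀ f, X ^ (n - 1) ∣
      R (X * b * f) - X * b * R f - X * f * (C d * b - q * derivative ℂ b) := by
    intro f
    have h := hrel f (E n 1) (E n 2)
    rw [r1, r2, hPE1, hPE2, ← hQ, ← hQ, show f * X * b = X * b * f by ring] at h
    obtain ⟨w, hw⟩ := h
    refine ⟨w, ?_⟩
    rw [hR, hR, Derivation.leibniz, Derivation.leibniz, derivative_X]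
    simp only [smul_eq_mul]
    linear_combination hw
  have hmain : X ^ (n - 3) ∣ q * derivative ℂ b - C d * b := by
    obtain ⟨w1, h1⟩ := hRb 1
    obtain ⟨w2, h2⟩ := hRb X
    obtain ⟨w3, h3⟩ := hR2 b
    obtain ⟨w4, h4⟩ := squareLinear_X_mul hR1 hR2 b
    obtain ⟨w5, h5⟩ := squareLinear_X_mul hR1 hR2 (X * b)
    obtain ⟨w6, h6⟩ := hR1
    rw [mul_one] at h1
    rw [show X * b * X = X ^ 2 * b by ring] at h2
    have h2C : (C (1 / 2 : ℂ) : ℂ⟦X⟧) * 2 = 1 := by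
      rw [show (2 : ℂ⟦X⟧) = C 2 from (map_ofNat C 2).symm, ← map_mul]; norm_num
    refine ⟨C (1 / 2) * (w2 - w3 + X * w1 - X * w4 + X * X * b * w6),
      mul_left_cancel₀ (pow_ne_zero 2 X_ne_zero) ?_⟩
    have e : 2 * (X ^ 2 * (q * derivative ℂ b - C d * b)) =
        X ^ (n - 1) * (w2 - w3 + X * w1 - X * w4 + X * X * b * w6) := by
      linear_combination h2 - h3 + X * h1 - X * h4 + X * X * b * h6
    rw [hX1] at e
    linear_combination C (1 / 2) * e - X ^ 2 * (q * derivative ℂ b - C d * b) * h2C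
  refine ⟨a, c, d, fun ha0 => hnil ?_, hmain⟩
  have hqb : q = C c * b := by rw [hq, ha0]; simp
  have hd00 : d = 0 := by
    by_contra hdne
    obtain ⟨s, hs⟩ := hb
    have hu : IsUnit (C c * derivative ℂ b - C d) := by
      rw [isUnit_iff_constantCoeff, isUnit_iff_ne_zero, hs, Derivation.leibniz,
        Derivation.leibniz_pow, derivative_X]
      simpa using hdne
    apply hb'
    rw [← hu.dvd_mul_left]
    convert hmain using 1
    rw [hqb]; ring
  have hq2 : X ^ 2 ∣ q := by rw [hqb]; exact dvd_mul_of_dvd_right hb _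
  have hpX : X ∣ p := by
    rw [X_dvd_iff, ← coeff_zero_eq_constantCoeff_apply, hp, coeff_toSeries_zero, ← ha, ha0]
  have hRX0 : constantCoeff (R X) = 0 := by
    have h0 : constantCoeff (Q X) = 0 := by
      rw [hQ, ← coeff_zero_eq_constantCoeff_apply, coeff_toSeries_zero]
      refine (hker _ ?_).1
      rw [rightSeries_ofSeries (by omega)]
      simp
    have h1 : constantCoeff q = 0 := X_dvd_iff.1 ((dvd_pow_self X two_ne_zero).trans hq2)
    rw [hR, map_sub, map_sub, h0, map_mul, map_mul, h1]
    simp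
  obtain ⟨u, hu⟩ := X_dvd_iff.2 hRX0
  have hu0 : constantCoeff u = 0 := by
    by_contra hne
    refine hbk (coeff_even_eq_zero_of_squareLinear (N := n - 1) (K := n - 3) (by omega) hR1 hR2
      hu hne ?_ hk hkn)
    obtain ⟨w1, h1⟩ := hRb 1
    obtain ⟨w2, h2⟩ := hmain
    obtain ⟨w3, h3⟩ := hR1
    rw [mul_one] at h1
    refine ⟨X * w1 - w2 + X ^ 2 * b * w3, ?_⟩
    have hX3 : (X : ℂ⟦X⟧) ^ (n - 1) = X ^ (n - 3 + 1) * X := by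
      rw [← pow_succ]; congr 1; omega
    have hX4 : (X : ℂ⟦X⟧) ^ (n - 3 + 1) = X ^ (n - 3) * X := pow_succ _ _
    rw [hX3] at h1 h3
    linear_combination h1 - X * h2 + X * b * h3 + w2 * hX4
  have hRX : X ^ 2 ∣ R X := by
    rw [hu, sq]
    exact mul_dvd_mul_left X (X_dvd_iff.2 hu0)
  refine isNilpotent_of_strictly_triangular P fun t ht htn j hj => ?_
  obtain rfl | rfl | ht3 : t = 1 ∨ t = 2 ∨ 3 ≤ t := by omega
  · obtain rfl : j = 0 := by omega
    rw [← ha, ha0]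
  · obtain rfl | rfl : j = 0 ∨ j = 1 := by omega
    · exact hd0
    · rw [← hd, hd00]
  · have hkt : rightSeries n b (E n t) = 0 := by
      rw [E_eq_ofSeries ht3, rightSeries_ofSeries (by omega), coeff_X_pow,
        if_neg (by omega)]
      simp
    rcases j with _ | _ | j
    · exact (hker _ hkt).1
    · exact (hker _ hkt).2
    · rw [← coeff_toSeries_succ]
      have hdvd : X ^ (t - 2 + 1) ∣ toSeries n (P (E n t)) := by
        rw [E_eq_ofSeries ht3, ← hQ]
        have e : Q (X ^ (t - 2)) = R (X ^ (t - 2)) + p * X ^ (t - 2) +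
            q * derivative ℂ (X ^ (t - 2)) := by rw [hR]; ring
        rw [e]
        refine dvd_add (dvd_add ?_ ?_) ?_
        · exact X_pow_succ_dvd_squareLinear hR1 hRX hR2 _ (by omega) _ dvd_rfl
        · rw [pow_succ']; exact mul_dvd_mul_right hpX _
        · rw [Derivation.leibniz_pow, derivative_X]
          obtain ⟨s, hs⟩ := hq2
          refine ⟨s * ((t - 2 : ℕ) : ℂ⟦X⟧), ?_⟩
          rw [hs, show t - 2 + 1 = t - 2 - 1 + 2 by omega, pow_add]
          simp only [smul_eq_mul, nsmul_eq_mul]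
          ring
      exact X_pow_dvd_iff.1 hdvd _ (by omega)

end PreDerivation

section NormalForm

open PowerSeries

variable {n : ℕ}

lemma betaSeries_add (β₁ β₂ : ℕ → ℂ) (y : ℂ⟦X⟧) :
    betaSeries n (β₁ + β₂) y = betaSeries n β₁ y + betaSeries n β₂ y := by
  simp [betaSeries, add_mul, Finset.sum_add_distrib]

lemma betaSeries_single {j : ℕ} (hj : 4 ≤ j) (hjn : j ≤ n) (c : ℂ) (y : ℂ⟦X⟧) :
    betaSeries n (Pi.single j c) y = C c * y ^ (j - 2) := by
  rw [betaSeries, Finset.sum_eq_single j]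
  · simp
  · intro t _ ht
    simp [ht]
  · intro h
    exact absurd (Finset.mem_Icc.2 ⟨hj, hjn⟩) h

/-- If `b` is a monomial `k y ^ m` up to order `n - 3`, the algebra is isomorphic to one whose
only non-zero parameters are `β'_{m+2} = 1`, `β'_{n-1}`, `β'_n` and `γ'`. -/
theorem exists_F2mul_of_eq_monomial (hn : 5 ≤ n) {b : ℂ⟦X⟧} (hb : X ^ 2 ∣ b) (γ : ℂ)
    {ε κ : ℂ} {m : ℕ} (hκ : κ ≠ 0) (hm : 2 ≤ m) (hmn : m < n - 3)
    (h : X ^ (n - 3) ∣ b - C κ * (X + C ε * b) ^ m) :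
    ∃ (β' : ℕ → ℂ) (γ' : ℂ),
      (∃ φ : (Fin n → ℂ) ≃ₗ[ℂ] (Fin n → ℂ), ∀ x y,
        φ (seriesBracket n b γ x y) = bracketOf n (F2mul n β' γ') (φ x) (φ y)) ∧
      β' (m + 2) = 1 ∧ ∀ j, j ≤ n - 2 → j ≠ m + 2 → β' j = 0 := by
  set y := X + C ε * b with hyb
  obtain ⟨v, hy⟩ : ∃ v, y = X * (1 + X * v) := by
    obtain ⟨s, hs⟩ := hb
    exact ⟨C ε * s, by rw [hyb, hs]; ring⟩
  set α₁ := coeff (n - 3) (b - C κ * y ^ m)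
  have h1 := X_pow_succ_dvd_sub hy h
  rw [show n - 3 + 1 = n - 2 by omega] at h1
  set α₂ := coeff (n - 2) (b - C κ * y ^ m - C α₁ * y ^ (n - 3))
  have h2 := X_pow_succ_dvd_sub hy h1
  have h3 := X_pow_succ_dvd_sub hy (dvd_refl (X ^ (n - 2)))
  rw [coeff_X_pow_self, map_one, one_mul] at h3
  rw [show n - 2 + 1 = n - 1 by omega] at h2 h3
  let β' : ℕ → ℂ := Pi.single (m + 2) 1 + Pi.single (n - 1) (κ⁻¹ * α₁) +
    Pi.single n (κ⁻¹ * (α₂ + ε * γ))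
  have hβ : X ^ (n - 1) ∣
      betaSeries n β' y - C κ⁻¹ * (b + C (ε * γ) * X ^ (n - 2)) := by
    rw [betaSeries_add, betaSeries_add, betaSeries_single (by omega) (by omega),
      betaSeries_single (by omega) (by omega), betaSeries_single (by omega) le_rfl,
      Nat.add_sub_cancel, show n - 1 - 2 = n - 3 by omega]
    obtain ⟨w2, h2⟩ := h2
    obtain ⟨w3, h3⟩ := h3
    have hC : (C κ⁻¹ : ℂ⟦X⟧) * C κ = 1 := by rw [← map_mul, inv_mul_cancel₀ hκ, map_one]
    refine ⟨-C κ⁻¹ * w2 - C κ⁻¹ * C (ε * γ) * w3, ?_⟩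
    simp only [map_mul, map_add, map_one] at h2 h3 ⊢
    linear_combination -C κ⁻¹ * h2 - C κ⁻¹ * C ε * C γ * h3 - y ^ m * hC
  obtain ⟨φ, hφ⟩ := exists_linearEquiv_seriesBracket (n := n) (γ := γ) hn hb hyb hy
    (inv_ne_zero hκ) hβ
  refine ⟨β', κ⁻¹ ^ 2 * γ, ⟨φ.symm, fun x z => ?_⟩, ?_, fun j hj hjm => ?_⟩
  · rw [LinearEquiv.symm_apply_eq, hφ, LinearEquiv.apply_symm_apply,
      LinearEquiv.apply_symm_apply]
  · simp [β', show m + 2 ≠ n - 1 by omega, show m + 2 ≠ n by omega]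
  · simp [β', hjm, show j ≠ n - 1 by omega, show j ≠ n by omega]

end NormalForm

/-- Theorem 4.5: for even `n`, every non-strongly nilpotent second-family
filiform Leibniz algebra `F2(β₄,…,βₙ,γ)` is isomorphic to one of the listed
algebras. -/
theorem stmt_6 (n : ℕ) (hne : Even n) (hn : 8 ≤ n) (β : ℕ → ℂ) (γ : ℂ)
    (hleib : ∀ x y z : Fin n → ℂ,
      bracketOf n (F2mul n β γ) (bracketOf n (F2mul n β γ) x y) z =
        bracketOf n (F2mul n β γ) (bracketOf n (F2mul n β γ) x z) y +
        bracketOf n (F2mul n β γ) x (bracketOf n (F2mul n β γ) y z))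
    (hns : ∃ P : Module.End ℂ (Fin n → ℂ),
      IsPreDeriv n (bracketOf n (F2mul n β γ)) P ∧ ¬ IsNilpotent P) :
    ∃ (β' : ℕ → ℂ) (γ' : ℂ),
      (∃ e : (Fin n → ℂ) ≃ₗ[ℂ] (Fin n → ℂ),
        ∀ x y, e (bracketOf n (F2mul n β γ) x y)
          = bracketOf n (F2mul n β' γ') (e x) (e y)) ∧
      ((∃ s, 2 ≤ s ∧ s ≤ (n - 2) / 2 ∧ β' (2 * s) = 1 ∧
          ∀ j, 4 ≤ j → j ≤ n - 2 → j ≠ 2 * s → β' j = 0) ∨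
       (∀ i, 2 ≤ i → i ≤ (n - 2) / 2 → β' (2 * i) = 0)) := by
  by_cases hev : ∀ i, 2 ≤ i → i ≤ (n - 2) / 2 → β (2 * i) = 0
  · exact ⟨β, γ, ⟨LinearEquiv.refl ℂ _, fun _ _ => rfl⟩, Or.inr hev⟩
  push Not at hev
  obtain ⟨i, hi, hin, hβi⟩ := hev
  have hbr := bracketOf_F2mul (n := n) (by omega) β γ
  have hb := X_sq_dvd_betaSeries (n := n) β
  obtain ⟨P, hP, hnil⟩ := hns
  rw [show bracketOf n (F2mul n β γ) = fun x y => seriesBracket n (betaSeries n β .X) γ x y from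
    funext fun x => funext fun y => hbr x y] at hP
  have hcoeff : PowerSeries.coeff (2 * i - 2) (betaSeries n β .X) ≠ 0 := by
    rwa [coeff_betaSeries β (by omega) (by omega), Nat.sub_add_cancel (by omega)]
  obtain ⟨a, c, d, ha, hbd⟩ := exists_eigenvector_of_preDeriv (by omega) hb hP hnil
    (k := 2 * i - 2) ⟨i - 1, by omega⟩ (by omega) hcoeff
  obtain ⟨ε, κ, m, hκ, hm, hmn, hmono⟩ := exists_eq_monomial_of_eigenvector ha hb
    (fun h => hcoeff (PowerSeries.X_pow_dvd_iff.1 h _ (by omega))) hbd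
  obtain ⟨β', γ', ⟨φ, hφ⟩, h1, h0⟩ :=
    exists_F2mul_of_eq_monomial (by omega) hb γ hκ hm hmn hmono
  refine ⟨β', γ', ⟨φ, fun x y => by rw [hbr, hφ]⟩, ?_⟩
  rcases Nat.even_or_odd' m with ⟨r, rfl | rfl⟩
  · refine Or.inl ⟨r + 1, by omega, by omega, ?_, fun j _ hj hjs => h0 j hj (by omega)⟩
    rwa [mul_add, mul_one]
  · exact Or.inr fun s _ hs => h0 _ (by omega) (by omega)
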